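/- In the Laplacian gadget, the first-order effect of the extra diagonal terms on the encoded qubits is E† (P_x + P_y + P_z) E = (4/3)·I₄ + (1/6)(X⊗X + Z⊗Z). -/

import Mathlib

open Matrix
open scoped Kronecker

noncomputable section

/-- Index type for the Fock space of 9 fermionic modes, `ℂ^512`.
Modes `i1,i2,i3,j1,j2,j3,x,y,z` are labelled `0,…,8` in this order. -/
abbrev Idx := Fin 9 → Bool

abbrev Mat := Matrix Idx Idx ℂ

/-- Jordan–Wigner annihilation operator `a_k = Z^{⊗(k-1)} ⊗ σ⁻ ⊗ I^{⊗(9-k)}`,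
written entrywise in the occupation-number basis (`false` = unoccupied `|0⟩`). -/
def a (k : Fin 9) : Mat :=
  Matrix.of fun s t =>
    if t k = true ∧ s = Function.update t k false then
      (-1 : ℂ) ^ (Finset.univ.filter fun l => l < k ∧ t l = true).card
    else 0

/-- Creation operator `a_k†`. -/
def ad (k : Fin 9) : Mat := (a k)ᴴ

/-- The vacuum state `|vac⟩ = |0⟩^{⊗9}`. -/
def vac : Idx → ℂ := fun t => if t = (fun _ => false) then 1 else 0

/-- `√3` as a complex number. -/
def s3 : ℂ := (Real.sqrt 3 : ℝ)

/-- The edges of the constraint graph `G_c`: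
`{i1,i2},{i2,i3},{i1,i3},{j1,j2},{j2,j3},{j1,j3},{i2,x},{j2,x},{i3,y},{j3,y},{i1,z},{j1,z}`. -/
def edges : Finset (Fin 9 × Fin 9) :=
  {(0,1), (1,2), (0,2), (3,4), (4,5), (3,5), (1,6), (4,6), (2,7), (5,7), (0,8), (3,8)}

/-- Adjacency in the constraint graph `G_c`. -/
def Adj (k l : Fin 9) : Prop := (k, l) ∈ edges ∨ (l, k) ∈ edges

instance (k l : Fin 9) : Decidable (Adj k l) := by unfold Adj; infer_instance

/-- `S` is an independent set of the constraint graph `G_c`. -/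
def IndepSet (S : Finset (Fin 9)) : Prop := ∀ k ∈ S, ∀ l ∈ S, ¬ Adj k l

instance (S : Finset (Fin 9)) : Decidable (IndepSet S) := by unfold IndepSet; infer_instance

/-- The Fock basis state `|S⟩` with exactly the modes in `S` occupied. -/
def fock (S : Finset (Fin 9)) : Idx → ℂ :=
  fun t => if t = (fun k => decide (k ∈ S)) then 1 else 0

/-- The set of occupied modes of an occupation vector. -/
def suppOf (t : Idx) : Finset (Fin 9) := Finset.univ.filter fun k => t k = true

/-- The two-particle constrained subspace: the span of the Fock states `|S⟩` over
independent sets `S` of `G_c` with `|S| = 2`. -/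
def C2 : Submodule ℂ (Idx → ℂ) :=
  Submodule.span ℂ {v | ∃ S : Finset (Fin 9), IndepSet S ∧ S.card = 2 ∧ v = fock S}

/-- `Π_c`, the orthogonal projector onto the two-particle constrained subspace.
Since that subspace is spanned by standard (Fock) basis vectors, the orthogonal
projector is the diagonal 0/1 matrix supported on those coordinates. -/
def Pic : Mat :=
  Matrix.diagonal fun t => if IndepSet (suppOf t) ∧ (suppOf t).card = 2 then 1 else 0

/-- `H_{0,i} = I + (a_{i1}†a_{i2}+h.c.) + (a_{i2}†a_{i3}+h.c.) + (a_{i3}†a_{i1}+h.c.)`. -/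
def H0i : Mat :=
  1 + (ad 0 * a 1 + ad 1 * a 0) + (ad 1 * a 2 + ad 2 * a 1) + (ad 2 * a 0 + ad 0 * a 2)

/-- `H_{0,j}`, defined analogously on modes `j1,j2,j3`. -/
def H0j : Mat :=
  1 + (ad 3 * a 4 + ad 4 * a 3) + (ad 4 * a 5 + ad 5 * a 4) + (ad 5 * a 3 + ad 3 * a 5)

/-- `H₀ = H_{0,i} + H_{0,j}`. -/
def H0 : Mat := H0i + H0j

/-- `S_{·,b}` on modes `k1,k2,k3`:
`S_{·,0} = (1/(2√3))((1−√3)a_{k3}† − 2a_{k1}† + (1+√3)a_{k2}†)` and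
`S_{·,1} = (1/(2√3))((1+√3)a_{k3}† − 2a_{k1}† + (1−√3)a_{k2}†)`. -/
def Senc (k1 k2 k3 : Fin 9) (b : Fin 2) : Mat :=
  if b = 0 then
    (1 / (2 * s3)) • ((1 - s3) • ad k3 - (2 : ℂ) • ad k1 + (1 + s3) • ad k2)
  else
    (1 / (2 * s3)) • ((1 + s3) • ad k3 - (2 : ℂ) • ad k1 + (1 - s3) • ad k2)

/-- The encoded two-qubit state `|bb'⟩_enc = S_{i,b} S_{j,b'} |vac⟩`. -/
def enc (b b' : Fin 2) : Idx → ℂ := (Senc 0 1 2 b * Senc 3 4 5 b').mulVec vac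

/-- The encoding isometry `E : ℂ⁴ → ℂ^512`, sending `|b⟩⊗|b'⟩` to `|bb'⟩_enc`. -/
def Eenc : Matrix Idx (Fin 2 × Fin 2) ℂ := Matrix.of fun t p => enc p.1 p.2 t

/-- `Π₋ = E E†`, the orthogonal projector onto the span of the four encoded states. -/
def Pim : Mat := Eenc * Eencᴴ

/-- `Π₊ = Π_c − Π₋`. -/
def Pip : Mat := Pic - Pim

/-- `V₁ = (a_{i2}†a_x+h.c.) + (a_{j2}†a_x+h.c.) + (a_{i3}†a_y+h.c.) + (a_{j3}†a_y+h.c.)`. -/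
def V1 : Mat :=
  (ad 1 * a 6 + ad 6 * a 1) + (ad 4 * a 6 + ad 6 * a 4)
    + (ad 2 * a 7 + ad 7 * a 2) + (ad 5 * a 7 + ad 7 * a 5)

/-- `V₂ = (a_{i1}†a_z+h.c.) + (a_{j1}†a_z+h.c.)`. -/
def V2 : Mat := (ad 0 * a 8 + ad 8 * a 0) + (ad 3 * a 8 + ad 8 * a 3)

/-- `V_main = V₁ + V₂`. -/
def Vmain : Mat := V1 + V2

/-- The Pauli matrix `X`. -/
def PX : Matrix (Fin 2) (Fin 2) ℂ := !![0, 1; 1, 0]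

/-- The Pauli matrix `Z`. -/
def PZ : Matrix (Fin 2) (Fin 2) ℂ := !![1, 0; 0, -1]

/-- `P_k = ∏_{l : {k,l} ∈ E(G_c)} (I − n_l)`, the product over the neighbours of
`k` in the constraint graph (the factors pairwise commute, so the product is
taken over the neighbours listed in increasing order). -/
def Pk (k : Fin 9) : Mat :=
  ((((Finset.univ.filter fun l => Adj k l)).sort (· ≤ ·)).map
    fun l => (1 : Mat) - ad l * a l).prod

/-- The Laplacian-gadget unperturbed Hamiltonian
`H₀' = (a_{i1}†a_{i2}+h.c.) + (a_{i2}†a_{i3}+h.c.) + (a_{i3}†a_{i1}+h.c.)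
     + (a_{j1}†a_{j2}+h.c.) + (a_{j2}†a_{j3}+h.c.) + (a_{j3}†a_{j1}+h.c.)
     + P_{i1} + P_{i2} + P_{i3} + P_{j1} + P_{j2} + P_{j3}`. -/
def H0' : Mat :=
  (ad 0 * a 1 + ad 1 * a 0) + (ad 1 * a 2 + ad 2 * a 1) + (ad 2 * a 0 + ad 0 * a 2)
    + (ad 3 * a 4 + ad 4 * a 3) + (ad 4 * a 5 + ad 5 * a 4) + (ad 5 * a 3 + ad 3 * a 5)
    + Pk 0 + Pk 1 + Pk 2 + Pk 3 + Pk 4 + Pk 5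

/-- The number operator `a_k†a_k` is diagonal in the occupation-number basis. -/
theorem ad_mul_a (k : Fin 9) :
    ad k * a k = Matrix.diagonal fun t : Idx => if t k = true then (1 : ℂ) else 0 := by
  ext s t
  rw [Matrix.mul_apply, Finset.sum_eq_single (Function.update t k false)]
  · by_cases hst : s = t
    · subst hst
      by_cases hk : s k = true
      · simp [ad, a, hk, ← mul_pow]
      · simp [a, hk]
    · rw [Matrix.diagonal_apply_ne _ hst]
      by_cases hk : t k = true
      · have : ¬ (s k = true ∧ Function.update t k false = Function.update s k false) := by
          rintro ⟨hs, h⟩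
          refine hst (funext fun l => ?_)
          by_cases hl : l = k
          · rw [hl, hs, hk]
          · simpa [hl] using (congrFun h l).symm
        simp [ad, a, this]
      · simp [a, hk]
  · intro u _ hu
    simp [a, hu]
  · simp

/-- `P_k` is diagonal, with entry `1` when all neighbours of `k` are unoccupied. -/
theorem Pk_eq_diagonal (k : Fin 9) :
    Pk k = Matrix.diagonal fun t : Idx =>
      if ∀ l, Adj k l → t l = false then (1 : ℂ) else 0 := by
  have h (l : Fin 9) : (1 : Mat) - ad l * a l =
      Matrix.diagonalRingHom Idx ℂ fun t => if t l = false then 1 else 0 := by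
    rw [ad_mul_a, ← Matrix.diagonal_one, Matrix.diagonal_sub, Matrix.diagonalRingHom_apply]
    congr 1
    funext t
    cases t l <;> simp
  unfold Pk
  simp only [h]
  rw [← Function.comp_def (Matrix.diagonalRingHom Idx ℂ), ← List.map_map, ← map_list_prod,
    ← Multiset.prod_coe, ← Multiset.map_coe, Finset.sort_eq, Matrix.diagonalRingHom_apply]
  congr 1
  funext t
  change (∏ l with Adj k l, fun t : Idx => if t l = false then (1 : ℂ) else 0) t = _
  rw [Finset.prod_apply, Finset.prod_ite_zero]
  simp

/-- Creating a particle in an empty mode with no occupied mode before it gives no sign. -/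
theorem ad_mulVec_single {k : Fin 9} {t : Idx} (ht : ∀ l ≤ k, t l = false) :
    ad k *ᵥ Pi.single t 1 = Pi.single (Function.update t k true) 1 := by
  ext s
  rw [Matrix.mulVec_single_one, Pi.single_apply, Matrix.col_apply, ad, Matrix.conjTranspose_apply,
    a, Matrix.of_apply]
  have hiff : (s k = true ∧ t = Function.update s k false) ↔ s = Function.update t k true := by
    constructor
    · rintro ⟨hs, rfl⟩
      simp [← hs]
    · rintro rfl
      simp [← ht k le_rfl]
  by_cases h : s = Function.update t k true
  · rw [if_pos (hiff.2 h), if_pos h, Finset.filter_eq_empty_iff.2]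
    · simp
    · rintro l - ⟨hl, hs⟩
      simp [h, hl.ne, ht l hl.le] at hs
  · rw [if_neg (mt hiff.1 h), if_neg h, star_zero]

theorem vac_eq_single : vac = Pi.single (fun _ => false) 1 := by
  ext t
  rw [vac, Pi.single_apply]

/-- The mode `i_{p+1}`. -/
def modeI (p : Fin 3) : Fin 9 := ![0, 1, 2] p

/-- The mode `j_{q+1}`. -/
def modeJ (q : Fin 3) : Fin 9 := ![3, 4, 5] q

/-- The occupation vector with exactly the modes `i_{p+1}` and `j_{q+1}` occupied. -/
def pairState (p q : Fin 3) : Idx :=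
  Function.update (Function.update (fun _ => false) (modeJ q) true) (modeI p) true

theorem pairState_injective : Function.Injective fun r : Fin 3 × Fin 3 => pairState r.1 r.2 := by
  decide

theorem ad_mul_ad_mulVec_vac (p q : Fin 3) :
    (ad (modeI p) * ad (modeJ q)) *ᵥ vac = Pi.single (pairState p q) 1 := by
  have hlt : ∀ p q : Fin 3, modeI p < modeJ q := by decide
  rw [vac_eq_single, ← Matrix.mulVec_mulVec, ad_mulVec_single fun _ _ => rfl, ad_mulVec_single,
    pairState]
  intro l hl
  rw [Function.update_of_ne (hl.trans_lt (hlt p q)).ne]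

/-- The amplitudes of the encoded states of one triangle on its three modes. -/
def amp : Matrix (Fin 3) (Fin 2) ℂ :=
  (1 / (2 * s3)) • !![-2, -2; 1 + s3, 1 - s3; 1 - s3, 1 + s3]

theorem Senc_eq_sum (m : Fin 3 → Fin 9) (b : Fin 2) :
    Senc (m 0) (m 1) (m 2) b = ∑ p, amp p b • ad (m p) := by
  fin_cases b <;> simp [Senc, amp, Fin.sum_univ_three] <;> module

theorem enc_eq_sum (b b' : Fin 2) :
    enc b b' = ∑ p, ∑ q, (amp p b * amp q b') • Pi.single (pairState p q) 1 := by
  change (Senc (modeI 0) (modeI 1) (modeI 2) b * Senc (modeJ 0) (modeJ 1) (modeJ 2) b') *ᵥ vac = _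
  simp only [Senc_eq_sum, Finset.sum_mul_sum, Matrix.sum_mulVec, smul_mul_smul_comm,
    Matrix.smul_mulVec, ad_mul_ad_mulVec_vac]

/-- The isometry that embeds the two-particle states `i_{p+1} j_{q+1}` into Fock space. -/
def pairEmb : Matrix Idx (Fin 3 × Fin 3) ℂ :=
  Matrix.of fun t r => if t = pairState r.1 r.2 then 1 else 0

theorem Eenc_eq : Eenc = pairEmb * (amp ⊗ₖ amp) := by
  ext t ⟨b, b'⟩
  simp [Eenc, enc_eq_sum, pairEmb, Matrix.mul_apply, Fintype.sum_prod_type, Pi.single_apply]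

theorem pairEmb_conj_diagonal (d : Idx → ℂ) :
    pairEmbᴴ * Matrix.diagonal d * pairEmb =
      Matrix.diagonal fun r : Fin 3 × Fin 3 => d (pairState r.1 r.2) := by
  ext r r'
  have h := pairState_injective.eq_iff (a := r) (b := r')
  simp only [Matrix.mul_apply, pairEmb, Matrix.diagonal_apply]
  by_cases hr : r = r'
  · simp [hr]
  · simp [hr, eq_comm, h]

/-- On the two-particle states `i_{p+1} j_{q+1}`, the sum `P_x + P_y + P_z` acts as
`1 + δ_{pq}`. -/
theorem pairEmb_conj_Pk_sum :
    pairEmbᴴ * (Pk 6 + Pk 7 + Pk 8) * pairEmb =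
      Matrix.diagonal fun r : Fin 3 × Fin 3 => 1 + if r.1 = r.2 then 1 else 0 := by
  simp only [Pk_eq_diagonal, Matrix.diagonal_add, pairEmb_conj_diagonal]
  have h6 : ∀ p q, (∀ l, Adj 6 l → pairState p q l = false) ↔ p ≠ 1 ∧ q ≠ 1 := by decide
  have h7 : ∀ p q, (∀ l, Adj 7 l → pairState p q l = false) ↔ p ≠ 2 ∧ q ≠ 2 := by decide
  have h8 : ∀ p q, (∀ l, Adj 8 l → pairState p q l = false) ↔ p ≠ 0 ∧ q ≠ 0 := by decide
  simp only [h6, h7, h8]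
  congr 1
  funext ⟨p, q⟩
  fin_cases p <;> fin_cases q <;> norm_num [Fin.ext_iff]

theorem s3_sq : s3 ^ 2 = 3 := by
  rw [s3, ← Complex.ofReal_pow, Real.sq_sqrt (by norm_num)]
  norm_num

theorem s3_ne_zero : s3 ≠ 0 := fun h => by simpa [h] using s3_sq

theorem star_s3 : (starRingEnd ℂ) s3 = s3 := Complex.conj_ofReal _

/-!
STATEMENT 18: In the Laplacian gadget, the first-order effect of the extra
diagonal terms on the encoded qubits:
`E† (P_x + P_y + P_z) E = (4/3)·I₄ + (1/6)(X⊗X + Z⊗Z)`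
(modes `x,y,z` are labelled `6,7,8`).
-/

theorem statement18 :
    Eencᴴ * (Pk 6 + Pk 7 + Pk 8) * Eenc =
      (4 / 3 : ℂ) • (1 : Matrix (Fin 2 × Fin 2) (Fin 2 × Fin 2) ℂ)
        + (1 / 6 : ℂ) • (PX ⊗ₖ PX + PZ ⊗ₖ PZ) := by
  rw [Eenc_eq, Matrix.conjTranspose_mul,
    show ∀ K M : Matrix (Fin 3 × Fin 3) (Fin 2 × Fin 2) ℂ, Kᴴ * pairEmbᴴ * (Pk 6 + Pk 7 + Pk 8) *
      (pairEmb * M) = Kᴴ * (pairEmbᴴ * (Pk 6 + Pk 7 + Pk 8) * pairEmb) * M from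
      fun K M => by simp only [Matrix.mul_assoc], pairEmb_conj_Pk_sum]
  have h4 : s3 ^ 4 = 9 := by linear_combination (s3 ^ 2 + 3) * s3_sq
  have h0 := s3_ne_zero
  ext ⟨b, b'⟩ ⟨c, c'⟩
  fin_cases b <;> fin_cases b' <;> fin_cases c <;> fin_cases c' <;>
    simp [Matrix.mul_apply, Matrix.diagonal_apply, Fintype.sum_prod_type, Fin.sum_univ_three, amp,
      PX, PZ, star_s3, Complex.conj_ofNat] <;>
    field_simp <;> ring_nf <;> simp only [s3_sq, h4] <;> norm_num

end
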